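/- arXiv:1907.11012 — 2 statements merged into one kernel-verified Lean document; each statement's English description precedes it below -/
import Mathlib

section
/- Suppose the unique solution (W_1,…,W_N) of the window IFS has vol(W_i) > 0 for every i and is row-wise measure-disjoint (for each i, any two of the sets Q·W_j + t with t ∈ T_{ij} corresponding to distinct pairs (j,t) intersect in a Lebesgue null set). Then each W_i ⊂ ℝ^m is a perfect set (it has no isolated points), is topologically regular (it equals the closure of its interior), and its boundary ∂W_i has Lebesgue measure 0. -/
open MeasureTheory Filter Matrix Topology Set

namespace WindowIFS

section general
set_option linter.unusedSectionVars false
variable {E : Type*} [NormedAddCommGroup E] [NormedSpace ℝ E] [FiniteDimensional ℝ E]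
  [MeasurableSpace E] [BorelSpace E] {N : ℕ}

/-- the level-`n` tile `Q^n A + s` -/
def tile (Q : E →L[ℝ] E) (n : ℕ) (s : E) (A : Set E) : Set E := (fun x => (Q ^ n) x + s) '' A

/-- level-`n` addresses -/
def addr (T : Fin N → Fin N → Finset E) (Q : E →L[ℝ] E) : ℕ → Fin N → Set (Fin N × E)
  | 0, i => {(i, 0)}
  | n + 1, i => ⋃ j, ⋃ t ∈ T i j, (fun p : Fin N × E => (p.1, Q p.2 + t)) '' addr T Q n j


theorem addr_finite (T : Fin N → Fin N → Finset E) (Q : E →L[ℝ] E) (n : ℕ) (i : Fin N) :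
    (addr T Q n i).Finite := by
  induction n generalizing i with
  | zero => exact finite_singleton _
  | succ n ih =>
    refine finite_iUnion fun j => ?_
    refine Set.Finite.biUnion (T i j).finite_toSet fun t _ => (ih j).image _


theorem mem_addr_succ {T : Fin N → Fin N → Finset E} {Q : E →L[ℝ] E} {n : ℕ} {i : Fin N}
    {p : Fin N × E} : p ∈ addr T Q (n + 1) i ↔
      ∃ j, ∃ t ∈ T i j, ∃ s, (p.1, s) ∈ addr T Q n j ∧ p.2 = Q s + t := by
  simp only [addr, mem_iUnion, mem_image]
  constructor
  · rintro ⟨j, t, ht, q, hq, rfl⟩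
    exact ⟨j, t, ht, q.2, hq, rfl⟩
  · rintro ⟨j, t, ht, s, hs, h⟩
    exact ⟨j, t, ht, (p.1, s), hs, by rw [← h]⟩


theorem tile_succ (Q : E →L[ℝ] E) (n : ℕ) (s t : E) (A : Set E) :
    tile Q (n + 1) (Q s + t) A = (fun x => Q x + t) '' tile Q n s A := by
  simp only [tile, image_image]
  refine image_congr fun x _ => ?_
  rw [pow_succ']
  simp [add_assoc]


theorem cover {T : Fin N → Fin N → Finset E} {Q : E →L[ℝ] E} {W : Fin N → Set E}
    (hIFS : ∀ i, W i = ⋃ j, ⋃ t ∈ T i j, (fun x => Q x + t) '' W j) (n : ℕ) (i : Fin N) :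
    W i = ⋃ p ∈ addr T Q n i, tile Q n p.2 (W p.1) := by
  induction n generalizing i with
  | zero => simp [addr, tile]
  | succ n ih =>
    ext x
    constructor
    · intro hx
      rw [hIFS i] at hx
      simp only [mem_iUnion] at hx ⊢
      obtain ⟨j, t, ht, y, hy, rfl⟩ := hx
      rw [ih j] at hy
      simp only [mem_iUnion] at hy
      obtain ⟨p, hp, hy⟩ := hy
      refine ⟨(p.1, Q p.2 + t), mem_addr_succ.2 ⟨j, t, ht, p.2, hp, rfl⟩, ?_⟩
      rw [tile_succ]
      exact ⟨y, hy, rfl⟩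
    · intro hx
      simp only [mem_iUnion] at hx
      obtain ⟨p, hp, hx⟩ := hx
      obtain ⟨j, t, ht, s, hs, h⟩ := mem_addr_succ.1 hp
      rw [h, tile_succ] at hx
      rw [hIFS i]
      simp only [mem_iUnion]
      refine ⟨j, t, ht, image_mono ?_ hx⟩
      rw [ih j]
      exact subset_biUnion_of_mem (u := fun p : Fin N × E => tile Q n p.2 (W p.1)) hs

theorem volume_tile (μ : Measure E) [μ.IsAddHaarMeasure] (Q : E →L[ℝ] E) (n : ℕ) (s : E)
    (A : Set E) : μ (tile Q n s A) = ENNReal.ofReal |Q.det| ^ n * μ A := by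
  have : tile Q n s A = (fun x => x + s) '' ((Q ^ n : E →L[ℝ] E) '' A) := by
    simp [tile, image_image]
  rw [this, image_add_right, measure_preimage_add_right,
    Measure.addHaar_image_continuousLinearMap]
  congr 1
  have : ((Q ^ n : E →L[ℝ] E) : E →ₗ[ℝ] E) = (Q : E →ₗ[ℝ] E) ^ n := by
    ext x; simp
  rw [this, map_pow, abs_pow, ENNReal.ofReal_pow (abs_nonneg _)]

theorem volume_tile_one (μ : Measure E) [μ.IsAddHaarMeasure] (Q : E →L[ℝ] E) (s : E)
    (A : Set E) : μ ((fun x => Q x + s) '' A) = ENNReal.ofReal |Q.det| * μ A := by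
  have := volume_tile μ Q 1 s A
  simpa [tile] using this

theorem disj (μ : Measure E) [μ.IsAddHaarMeasure] {T : Fin N → Fin N → Finset E} {Q : E →L[ℝ] E}
    (hQ : Function.Injective Q) {W : Fin N → Set E}
    (hIFS : ∀ i, W i = ⋃ j, ⋃ t ∈ T i j, (fun x => Q x + t) '' W j)
    (hdisj : ∀ i j j' : Fin N, ∀ t ∈ T i j, ∀ t' ∈ T i j', (j, t) ≠ (j', t') →
      μ (((fun x => Q x + t) '' W j) ∩ ((fun x => Q x + t') '' W j')) = 0)
    (n : ℕ) (i : Fin N) (p p' : Fin N × E) (hp : p ∈ addr T Q n i) (hp' : p' ∈ addr T Q n i)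
    (hne : p ≠ p') : μ (tile Q n p.2 (W p.1) ∩ tile Q n p'.2 (W p'.1)) = 0 := by
  induction n generalizing i p p' with
  | zero =>
    simp only [addr, mem_singleton_iff] at hp hp'
    exact absurd (hp.trans hp'.symm) hne
  | succ n ih =>
    obtain ⟨j, t, ht, s, hs, h⟩ := mem_addr_succ.1 hp
    obtain ⟨j', t', ht', s', hs', h'⟩ := mem_addr_succ.1 hp'
    rw [h, h', tile_succ, tile_succ]
    have sub : ∀ (j : Fin N) (p : Fin N × E), p ∈ addr T Q n j → tile Q n p.2 (W p.1) ⊆ W j := by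
      intro j p hp
      rw [cover hIFS n j]
      exact subset_biUnion_of_mem (u := fun p : Fin N × E => tile Q n p.2 (W p.1)) hp
    by_cases heq : (j, t) = (j', t')
    · obtain ⟨rfl, rfl⟩ := Prod.mk.inj heq
      rw [← image_inter (fun x y hxy => hQ (add_right_cancel hxy)), volume_tile_one]
      rw [ih j (p.1, s) (p'.1, s') hs hs', mul_zero]
      intro hh
      apply hne
      obtain ⟨h1, h2⟩ := Prod.mk.inj hh
      exact Prod.ext h1 (by rw [h, h', h2])
    · refine measure_mono_null (inter_subset_inter ?_ ?_) (hdisj i j j' t ht t' ht' heq)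
      · exact image_mono (sub j _ hs)
      · exact image_mono (sub j' _ hs')


theorem prim {T : Fin N → Fin N → Finset E} {Q : E →L[ℝ] E} {M : Matrix (Fin N) (Fin N) ℝ}
    (hM : ∀ i j, M i j = (T i j).card) (n : ℕ) (i j : Fin N) (h : (M ^ n) i j ≠ 0) :
    ∃ s, (j, s) ∈ addr T Q n i := by
  induction n generalizing i with
  | zero =>
    have : i = j := by
      by_contra hij
      simp [hij] at h
    subst this
    exact ⟨0, rfl⟩
  | succ n ih =>
    rw [pow_succ', Matrix.mul_apply] at h
    obtain ⟨l, -, hl⟩ := Finset.exists_ne_zero_of_sum_ne_zero h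
    obtain ⟨s, hs⟩ := ih l (right_ne_zero_of_mul hl)
    have h1 := left_ne_zero_of_mul hl
    rw [hM, Nat.cast_ne_zero, Finset.card_ne_zero] at h1
    obtain ⟨t, ht⟩ := h1
    exact ⟨Q s + t, mem_addr_succ.2 ⟨l, t, ht, s, hs, rfl⟩⟩


/-- averaging -/
theorem averaging
    (μ : Measure E) [μ.IsAddHaarMeasure] {W C : Set E} (hW : IsCompact W)
    (hC : MeasurableSet C) (hC0 : μ C ≠ 0) (hCt : μ C ≠ ⊤) {δ : ℝ} {ε : ENNReal}
    (hCδ : ∀ z ∈ C, ‖z‖ ≤ δ) (hδ : μ (Metric.cthickening δ W \ W) < ε * μ W) :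
    ∃ y ∈ W, μ ((fun z => z + y) '' C \ W) < ε * μ C := by
  by_contra! hcon
  set A : Set (E × E) := {p | p.1 ∈ W ∧ p.2 ∈ C ∧ p.2 + p.1 ∉ W} with hA
  have hWm : MeasurableSet W := hW.isClosed.measurableSet
  have hAm : MeasurableSet A := by
    refine (measurable_fst hWm).inter ((measurable_snd hC).inter ?_)
    exact ((measurable_snd.add measurable_fst) hWm).compl
  have h1 : ε * μ C * μ W ≤ (μ.prod μ) A := by
    rw [Measure.prod_apply hAm, ← setLIntegral_const]
    refine (setLIntegral_mono' (g := fun x => μ (Prod.mk x ⁻¹' A)) hWm ?_).trans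
      (setLIntegral_le_lintegral _ _)
    intro y hy
    refine (hcon y hy).trans (le_of_eq ?_)
    have : (fun z => z + y) '' C \ W = (fun z => z + y) '' (Prod.mk y ⁻¹' A) := by
      ext z
      simp only [hA, Set.mem_sdiff, mem_image, mem_preimage, mem_ofPred_eq]
      constructor
      · rintro ⟨⟨c, hc, rfl⟩, h⟩
        exact ⟨c, ⟨hy, hc, h⟩, rfl⟩
      · rintro ⟨c, ⟨_, hc, h⟩, rfl⟩
        exact ⟨⟨c, hc, rfl⟩, h⟩
    rw [this, image_add_right, measure_preimage_add_right]
  have h2 : (μ.prod μ) A ≤ μ (Metric.cthickening δ W \ W) * μ C := by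
    rw [Measure.prod_apply_symm hAm, ← setLIntegral_const,
      ← lintegral_indicator hC]
    refine lintegral_mono fun z => ?_
    by_cases hz : z ∈ C
    · rw [indicator_of_mem hz, ← measure_preimage_add_right μ (-z) ((fun x => (x, z)) ⁻¹' A)]
      refine measure_mono ?_
      intro x hx
      simp only [hA, mem_preimage, mem_ofPred_eq] at hx
      obtain ⟨hx1, hx2, hx3⟩ := hx
      refine ⟨?_, by simpa using hx3⟩
      refine Metric.mem_cthickening_of_dist_le x _ δ W hx1 ?_
      simpa [dist_eq_norm] using hCδ z hz
    · rw [indicator_of_notMem hz]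
      have : (fun x => (x, z)) ⁻¹' A = ∅ := by
        ext x; simp [hA, hz]
      simp [this]
  have h3 : μ (Metric.cthickening δ W \ W) * μ C < ε * μ W * μ C :=
    (ENNReal.mul_lt_mul_iff_left hC0 hCt).2 hδ
  have := (h1.trans h2).trans_lt h3
  rw [mul_right_comm] at this
  exact lt_irrefl _ this

theorem compactness (μ : Measure E) [μ.IsAddHaarMeasure] {W : Fin N → Set E}
    (hW : ∀ i, IsCompact (W i)) (K : ℕ) (R : ℝ)
    (h : ∀ ε : ENNReal, 0 < ε → ∃ σ : Fin K → Fin N × E, (∀ k, ‖(σ k).2‖ ≤ R) ∧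
      μ (Metric.ball 0 1 \ ⋃ k, (fun x => x + (σ k).2) '' W (σ k).1) ≤ ε) :
    ∃ j, (interior (W j)).Nonempty := by
  have hpos : ∀ n : ℕ, (0 : ENNReal) < ((n : ENNReal) + 1)⁻¹ := by
    intro n; simp [ENNReal.add_eq_top]
  choose σ hσR hσ using fun n : ℕ => h _ (hpos n)
  have hcomp : IsCompact (Set.pi univ
      (fun _ : Fin K => (univ : Set (Fin N)) ×ˢ Metric.closedBall (0 : E) R)) :=
    isCompact_univ_pi fun _ => isCompact_univ.prod (isCompact_closedBall 0 R)
  obtain ⟨τ, -, φ, hφ, hlim⟩ := hcomp.tendsto_subseq (x := σ)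
    (fun n k _ => ⟨mem_univ _, by simpa using hσR n k⟩)
  have hcl : ∀ k, IsClosed ((fun x => x + (τ k).2) '' W (τ k).1) := fun k =>
    ((hW _).image (continuous_add_right _)).isClosed
  have hU : Metric.ball (0 : E) 1 ⊆ ⋃ k, (fun x => x + (τ k).2) '' W (τ k).1 := by
    intro p hp
    by_contra hpU
    have hopen : IsOpen (Metric.ball (0 : E) 1 \ ⋃ k, (fun x => x + (τ k).2) '' W (τ k).1) :=
      Metric.isOpen_ball.sdiff (isClosed_iUnion_of_finite hcl)
    obtain ⟨δ, hδ, hsub⟩ := Metric.isOpen_iff.1 hopen p ⟨hp, hpU⟩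
    have hev : ∀ᶠ n in atTop, ∀ k, (σ (φ n) k).1 = (τ k).1 ∧ dist (σ (φ n) k).2 (τ k).2 < δ / 2 := by
      rw [eventually_all]
      intro k
      have hk := (tendsto_pi_nhds.1 hlim) k
      have hk1 := (continuous_fst.tendsto _).comp hk
      have hk2 := (continuous_snd.tendsto _).comp hk
      rw [nhds_discrete, tendsto_pure] at hk1
      have hk3 := hk2 (Metric.ball_mem_nhds _ (half_pos hδ))
      filter_upwards [hk1, hk3] with n h1 h2
      exact ⟨h1, h2⟩
    have hle : ∀ᶠ n in atTop, μ (Metric.ball p (δ / 2)) ≤ ((φ n : ENNReal) + 1)⁻¹ := by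
      filter_upwards [hev] with n hn
      refine le_trans (measure_mono ?_) (hσ (φ n))
      intro z hz
      refine ⟨(hsub (Metric.ball_subset_ball (by linarith) hz)).1, ?_⟩
      intro hzU
      simp only [mem_iUnion, mem_image] at hzU
      obtain ⟨k, w, hw, rfl⟩ := hzU
      obtain ⟨h1, h2⟩ := hn k
      have hmem : w + (τ k).2 ∈ Metric.ball p δ := by
        rw [Metric.mem_ball] at hz ⊢
        have : dist (w + (τ k).2) (w + (σ (φ n) k).2) < δ / 2 := by
          rw [dist_add_left, dist_comm]; exact h2
        linarith [dist_triangle (w + (τ k).2) (w + (σ (φ n) k).2) p]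
      refine (hsub hmem).2 ?_
      simp only [mem_iUnion, mem_image]
      exact ⟨k, w, h1 ▸ hw, rfl⟩
    have hto : Tendsto (fun n => ((φ n : ENNReal) + 1)⁻¹) atTop (𝓝 0) := by
      have h0 : Tendsto (fun n : ℕ => ((n : ENNReal) + 1)⁻¹) atTop (𝓝 0) := by
        have := (tendsto_add_atTop_iff_nat 1).2 ENNReal.tendsto_inv_nat_nhds_zero
        simpa using this
      exact h0.comp hφ.tendsto_atTop
    have := ge_of_tendsto hto hle
    exact (Metric.measure_ball_pos μ p (half_pos hδ)).not_ge this
  by_contra! hemp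
  have hd : Dense (⋂ k : Fin K, ((fun x => x + (τ k).2) '' W (τ k).1)ᶜ) := by
    refine dense_iInter_of_isOpen (fun k => (hcl k).isOpen_compl) (fun k => ?_)
    rw [← interior_eq_empty_iff_dense_compl]
    have := (Homeomorph.addRight (τ k).2).image_interior (W (τ k).1)
    rw [hemp, image_empty] at this
    exact this.symm
  obtain ⟨x, hx, hx2⟩ := hd.exists_mem_open Metric.isOpen_ball (Metric.nonempty_ball.2 one_pos : (Metric.ball (0:E) 1).Nonempty)
  rw [← compl_iUnion] at hx
  exact hx (hU hx2)


theorem exists_config (μ : Measure E) [μ.IsAddHaarMeasure] {T : Fin N → Fin N → Finset E}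
    {Q : E →L[ℝ] E} (hQ : Function.Injective Q) (hQ1 : ‖Q‖ < 1) (hdet : Q.det ≠ 0)
    {W : Fin N → Set E} (hW : ∀ i, IsCompact (W i)) (hvol : ∀ i, 0 < μ (W i))
    (hIFS : ∀ i, W i = ⋃ j, ⋃ t ∈ T i j, (fun x => Q x + t) '' W j)
    (hdisj : ∀ i j j' : Fin N, ∀ t ∈ T i j, ∀ t' ∈ T i j', (j, t) ≠ (j', t') →
      μ (((fun x => Q x + t) '' W j) ∩ ((fun x => Q x + t') '' W j')) = 0)
    {D : ℝ} (hD0 : 0 ≤ D) (hD : ∀ j, ∀ x ∈ W j, ‖x‖ ≤ D) (i : Fin N) :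
    ∃ K : ℕ, ∀ ε : ENNReal, 0 < ε → ∃ σ : Fin K → Fin N × E, (∀ k, ‖(σ k).2‖ ≤ 1 + D) ∧
      μ (Metric.ball 0 1 \ ⋃ k, (fun x => x + (σ k).2) '' W (σ k).1) ≤ ε := by
  classical
  set c : ENNReal := ENNReal.ofReal |Q.det| with hc
  have hc0 : ∀ n : ℕ, c ^ n ≠ 0 := fun n => pow_ne_zero _ (by simpa [hc] using hdet)
  have hct : ∀ n : ℕ, c ^ n ≠ ⊤ := fun n => ENNReal.pow_ne_top ENNReal.ofReal_ne_top
  have hQn : ∀ n : ℕ, Function.Injective (Q ^ n : E →L[ℝ] E) := by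
    intro n
    rw [ContinuousLinearMap.coe_pow']
    exact hQ.iterate n
  set B : Set E := Metric.closedBall 0 1 with hB
  have hBc : IsCompact B := isCompact_closedBall 0 1
  have hB0 : μ B ≠ 0 := (Metric.measure_closedBall_pos μ 0 one_pos).ne'
  have hBt : μ B ≠ ⊤ := hBc.measure_lt_top.ne
  have : Nonempty (Fin N) := ⟨i⟩
  obtain ⟨j0, hj0⟩ := Finite.exists_min (fun j => μ (W j))
  set V : ENNReal := μ (Metric.closedBall (0 : E) (1 + 2 * D)) with hV
  have hVt : V ≠ ⊤ := (isCompact_closedBall _ _).measure_lt_top.ne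
  obtain ⟨K, hK⟩ := ENNReal.exists_nat_gt (ENNReal.div_ne_top hVt (hvol j0).ne')
  refine ⟨K, fun ε hε => ?_⟩
  -- choose n
  have hε' : ε / μ B ≠ 0 := by simp [ENNReal.div_eq_zero_iff, hε.ne', hBt]
  have hWt : μ (W i) ≠ ⊤ := (hW i).measure_lt_top.ne
  obtain ⟨n, hn⟩ : ∃ n : ℕ, μ (Metric.cthickening (‖Q‖ ^ n) (W i) \ W i) < ε / μ B * μ (W i) := by
    have h1 := tendsto_measure_cthickening_of_isCompact (μ := μ) (hW i)
    have h2 := h1.comp (tendsto_pow_atTop_nhds_zero_of_lt_one (norm_nonneg Q) hQ1)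
    have h3 : μ (W i) < ε / μ B * μ (W i) + μ (W i) := by
      rw [add_comm]
      exact ENNReal.lt_add_right hWt (mul_ne_zero hε' (hvol i).ne')
    obtain ⟨n, hn⟩ := (h2.eventually (gt_mem_nhds h3)).exists
    refine ⟨n, ?_⟩
    rw [measure_sdiff (Metric.self_subset_cthickening _)
      (hW i).isClosed.measurableSet.nullMeasurableSet hWt]
    exact ENNReal.sub_lt_of_lt_add (measure_mono (Metric.self_subset_cthickening _)) hn
  have hCc : IsCompact (tile Q n 0 B) :=
    hBc.image ((Q ^ n : E →L[ℝ] E).continuous.add continuous_const)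
  obtain ⟨y, hy, hyC⟩ := averaging μ (hW i) (C := tile Q n 0 B) hCc.isClosed.measurableSet
    (by rw [volume_tile]; exact mul_ne_zero (hc0 n) hB0) hCc.measure_lt_top.ne
    (by
      rintro z ⟨b, hb, rfl⟩
      have hb' : ‖b‖ ≤ 1 := by simpa [hB] using hb
      simp only [add_zero]
      calc ‖(Q ^ n : E →L[ℝ] E) b‖ ≤ ‖(Q ^ n : E →L[ℝ] E)‖ * ‖b‖ := ContinuousLinearMap.le_opNorm _ _
        _ ≤ ‖(Q ^ n : E →L[ℝ] E)‖ * 1 := by gcongr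
        _ = ‖(Q ^ n : E →L[ℝ] E)‖ := mul_one _
        _ ≤ ‖Q‖ ^ n := by
          rcases Nat.eq_zero_or_pos n with rfl | hn0
          · rw [pow_zero, pow_zero]; exact ContinuousLinearMap.norm_id_le
          · exact norm_pow_le' Q hn0) hn
  have hCy : (fun z => z + y) '' tile Q n 0 B = tile Q n y B := by
    simp [tile, image_image]
  rw [hCy, volume_tile, ← hc] at hyC
  -- the tiles meeting the patch
  set P : Finset (Fin N × E) := (addr_finite T Q n i).toFinset.filter
    (fun p => (tile Q n p.2 (W p.1) ∩ tile Q n y B).Nonempty) with hP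
  have hPmem : ∀ p ∈ P, p ∈ addr T Q n i := by
    intro p hp
    simpa using (Finset.mem_filter.1 hp).1
  have hs : ∀ p ∈ P, ∃ s', ‖s'‖ ≤ 1 + D ∧ p.2 = (Q ^ n : E →L[ℝ] E) s' + y := by
    intro p hp
    obtain ⟨z, ⟨w, hw, hwz⟩, ⟨b, hb, hbz⟩⟩ := (Finset.mem_filter.1 hp).2
    have hb' : ‖b‖ ≤ 1 := by simpa [hB] using hb
    refine ⟨b - w, (norm_sub_le _ _).trans (add_le_add hb' (hD _ _ hw)), ?_⟩
    simp only at hwz hbz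
    rw [map_sub, sub_add_eq_add_sub, hbz, ← hwz, add_sub_cancel_left]
  choose! f hf1 hf2 using hs
  have hcard : P.card ≤ K := by
    have hsub : (⋃ p ∈ P, tile Q n p.2 (W p.1)) ⊆
        tile Q n y (Metric.closedBall (0 : E) (1 + 2 * D)) := by
      refine iUnion₂_subset fun p hp => ?_
      rintro _ ⟨w, hw, rfl⟩
      refine ⟨w + f p, ?_, ?_⟩
      · rw [mem_closedBall_zero_iff]
        linarith [norm_add_le w (f p), hD _ _ hw, hf1 p hp]
      · simp only
        rw [map_add, add_assoc, ← hf2 p hp]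
    have h1 := measure_mono (μ := μ) hsub
    rw [measure_biUnion_finset₀ ?_ ?_] at h1
    · simp only [volume_tile, ← hc] at h1
      have h2 : (P.card : ENNReal) * (c ^ n * μ (W j0)) ≤ c ^ n * V := by
        refine le_trans ?_ h1
        rw [← nsmul_eq_mul]
        refine Finset.card_nsmul_le_sum _ _ _ fun p _ => ?_
        exact mul_le_mul_right (hj0 p.1) _
      rw [mul_left_comm, ENNReal.mul_le_mul_iff_right (hc0 n) (hct n)] at h2
      have h3 : (P.card : ENNReal) ≤ V / μ (W j0) :=
        (ENNReal.le_div_iff_mul_le (Or.inl (hvol j0).ne') (Or.inl (hW j0).measure_lt_top.ne)).2 h2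
      exact_mod_cast (h3.trans hK.le)
    · intro p hp q hq hpq
      exact disj μ hQ hIFS hdisj n i p q (hPmem p hp) (hPmem q hq) hpq
    · intro p hp
      exact ((hW p.1).image ((Q ^ n : E →L[ℝ] E).continuous.add
        continuous_const)).isClosed.measurableSet.nullMeasurableSet
  let e := P.equivFin
  refine ⟨fun k => if h : (k : ℕ) < P.card then
    ((e.symm ⟨k, h⟩ : Fin N × E).1, f (e.symm ⟨k, h⟩ : Fin N × E)) else (i, 0), ?_, ?_⟩
  · intro k
    by_cases h : (k : ℕ) < P.card
    · simpa only [h, dif_pos] using hf1 _ (e.symm ⟨k, h⟩).2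
    · simp only [h, dif_neg, not_false_eq_true, norm_zero]
      positivity
  · set U : Set E := ⋃ p ∈ P, (fun x => x + f p) '' W p.1 with hU
    have hUsub : μ (B \ U) ≤ ε := by
      have hsub : tile Q n y (B \ U) ⊆ tile Q n y B \ W i := by
        rintro _ ⟨z, ⟨hzB, hzU⟩, rfl⟩
        refine ⟨⟨z, hzB, rfl⟩, fun hzW => hzU ?_⟩
        rw [cover hIFS n i] at hzW
        simp only [mem_iUnion] at hzW
        obtain ⟨p, hp, hzp⟩ := hzW
        have hpP : p ∈ P := by
          refine Finset.mem_filter.2 ⟨by simpa using hp, ⟨_, hzp, ⟨z, hzB, rfl⟩⟩⟩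
        obtain ⟨w, hw, hwz⟩ := hzp
        simp only at hwz
        rw [hf2 p hpP, ← add_assoc, ← map_add] at hwz
        have := hQn n (add_right_cancel hwz)
        simp only [hU, mem_iUnion]
        exact ⟨p, hpP, w, hw, this⟩
      have h1 := (measure_mono (μ := μ) hsub).trans hyC.le
      rw [volume_tile, ← hc, mul_left_comm, ENNReal.div_mul_cancel hB0 hBt,
        ENNReal.mul_le_mul_iff_right (hc0 n) (hct n)] at h1
      exact h1
    refine le_trans (measure_mono ?_) hUsub
    refine sdiff_subset_sdiff Metric.ball_subset_closedBall ?_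
    refine iUnion₂_subset fun p hp => ?_
    have hlt : ((e ⟨p, hp⟩ : Fin P.card) : ℕ) < P.card := (e ⟨p, hp⟩).2
    refine subset_trans ?_ (subset_iUnion _ (⟨(e ⟨p, hp⟩ : ℕ), hlt.trans_le hcard⟩ : Fin K))
    simp

theorem exists_interior (μ : Measure E) [μ.IsAddHaarMeasure] {T : Fin N → Fin N → Finset E}
    {Q : E →L[ℝ] E} (hQ : Function.Bijective Q) (hQ1 : ‖Q‖ < 1) (hdet : Q.det ≠ 0)
    {W : Fin N → Set E} (hW : ∀ i, IsCompact (W i)) (hvol : ∀ i, 0 < μ (W i))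
    (hIFS : ∀ i, W i = ⋃ j, ⋃ t ∈ T i j, (fun x => Q x + t) '' W j)
    (hdisj : ∀ i j j' : Fin N, ∀ t ∈ T i j, ∀ t' ∈ T i j', (j, t) ≠ (j', t') →
      μ (((fun x => Q x + t) '' W j) ∩ ((fun x => Q x + t') '' W j')) = 0)
    {D : ℝ} (hD0 : 0 ≤ D) (hD : ∀ j, ∀ x ∈ W j, ‖x‖ ≤ D) (i : Fin N) :
    ∃ j, (interior (W j)).Nonempty := by
  obtain ⟨K, hK⟩ := exists_config μ hQ.1 hQ1 hdet hW hvol hIFS hdisj hD0 hD i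
  exact compactness μ hW K _ hK

theorem tile_homeo {Q : E →L[ℝ] E} (hQ : Function.Bijective Q) (n : ℕ) (s : E) :
    ∃ h : E ≃ₜ E, ∀ A, tile Q n s A = h '' A := by
  have hb : Function.Bijective (Q ^ n : E →L[ℝ] E) := by
    rw [ContinuousLinearMap.coe_pow']
    exact hQ.iterate n
  let e := (LinearEquiv.ofBijective ((Q ^ n : E →L[ℝ] E) : E →ₗ[ℝ] E) hb).toContinuousLinearEquiv
  refine ⟨e.toHomeomorph.trans (Homeomorph.addRight s), fun A => ?_⟩
  rfl

theorem tile_small {Q : E →L[ℝ] E} {W : Fin N → Set E}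
    {D : ℝ} (hD : ∀ j, ∀ x ∈ W j, ‖x‖ ≤ D) (n : ℕ) (s : E) (j : Fin N)
    {x y : E} (hx : x ∈ tile Q n s (W j)) (hy : y ∈ tile Q n s (W j)) :
    dist x y ≤ ‖Q‖ ^ n * (2 * D) := by
  obtain ⟨a, ha, rfl⟩ := hx
  obtain ⟨b, hb, rfl⟩ := hy
  simp only [dist_add_right]
  rw [dist_eq_norm, ← map_sub]
  have hn : ‖(Q ^ n : E →L[ℝ] E)‖ ≤ ‖Q‖ ^ n := by
    rcases Nat.eq_zero_or_pos n with rfl | hn0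
    · rw [pow_zero, pow_zero]; exact ContinuousLinearMap.norm_id_le
    · exact norm_pow_le' Q hn0
  refine (ContinuousLinearMap.le_opNorm _ _).trans ?_
  have : ‖a - b‖ ≤ 2 * D := by linarith [norm_sub_le a b, hD _ _ ha, hD _ _ hb]
  gcongr

theorem finset_frontier {ι : Type*} (P : Finset ι) (f : ι → Set E) :
    frontier (⋃ p ∈ P, f p) ⊆ ⋃ p ∈ P, frontier (f p) := by
  classical
  induction P using Finset.induction_on with
  | empty => simp
  | insert a P ha ih =>
    rw [Finset.set_biUnion_insert, Finset.set_biUnion_insert]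
    refine (frontier_union_subset _ _).trans ?_
    exact union_subset_union inter_subset_left (inter_subset_right.trans ih)

theorem frontier_null (μ : Measure E) [μ.IsAddHaarMeasure] {T : Fin N → Fin N → Finset E}
    {Q : E →L[ℝ] E} (hQ : Function.Bijective Q) (hQ1 : ‖Q‖ < 1) (hdet : Q.det ≠ 0)
    {W : Fin N → Set E} (hW : ∀ i, IsCompact (W i)) (hvol : ∀ i, 0 < μ (W i))
    (hIFS : ∀ i, W i = ⋃ j, ⋃ t ∈ T i j, (fun x => Q x + t) '' W j)
    (hdisj : ∀ i j j' : Fin N, ∀ t ∈ T i j, ∀ t' ∈ T i j', (j, t) ≠ (j', t') →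
      μ (((fun x => Q x + t) '' W j) ∩ ((fun x => Q x + t') '' W j')) = 0)
    {D : ℝ} (hD : ∀ j, ∀ x ∈ W j, ‖x‖ ≤ D)
    (hintW : ∀ i, (interior (W i)).Nonempty) (i : Fin N) : μ (frontier (W i)) = 0 := by
  classical
  have : Nonempty (Fin N) := ⟨i⟩
  have hWt : ∀ j, μ (W j) ≠ ⊤ := fun j => (hW j).measure_lt_top.ne
  obtain ⟨i0, hi0⟩ := Finite.exists_max (fun j => μ (frontier (W j)) / μ (W j))
  set r : ENNReal := μ (frontier (W i0)) / μ (W i0) with hr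
  have hrb : ∀ j, μ (frontier (W j)) ≤ r * μ (W j) := fun j =>
    (ENNReal.div_le_iff (hvol j).ne' (hWt j)).1 (hi0 j)
  have hr0eq : μ (frontier (W i0)) = r * μ (W i0) :=
    (ENNReal.div_mul_cancel (hvol i0).ne' (hWt i0)).symm
  have hft : μ (frontier (W i0)) ≠ ⊤ :=
    ((measure_mono (hW i0).isClosed.frontier_subset).trans_lt (hW i0).measure_lt_top).ne
  suffices hr0 : r = 0 by
    have := hrb i
    rw [hr0, zero_mul] at this
    exact le_antisymm this zero_le
  by_contra hr0
  set c : ENNReal := ENNReal.ofReal |Q.det| with hc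
  have hc0 : ∀ n : ℕ, c ^ n ≠ 0 := fun n => pow_ne_zero _ (by simpa [hc] using hdet)
  obtain ⟨x, hx⟩ := hintW i0
  obtain ⟨δ, hδ, hball⟩ := Metric.isOpen_iff.1 isOpen_interior x hx
  obtain ⟨n, hn⟩ : ∃ n : ℕ, ‖Q‖ ^ n * (2 * D) < δ := by
    have := (tendsto_pow_atTop_nhds_zero_of_lt_one (norm_nonneg Q) hQ1).mul_const (2 * D)
    rw [zero_mul] at this
    exact (this.eventually (gt_mem_nhds hδ)).exists
  set P := (addr_finite T Q n i0).toFinset with hP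
  have hcov : W i0 = ⋃ p ∈ P, tile Q n p.2 (W p.1) := by
    rw [cover hIFS n i0]; simp [hP]
  have hxW : x ∈ ⋃ p ∈ P, tile Q n p.2 (W p.1) := hcov ▸ interior_subset hx
  simp only [mem_iUnion] at hxW
  obtain ⟨q, hq, hxq⟩ := hxW
  have hqint : tile Q n q.2 (W q.1) ⊆ interior (W i0) := fun z hz =>
    hball ((tile_small hD n q.2 q.1 hz hxq).trans_lt hn)
  have hfr : ∀ p : Fin N × E, frontier (tile Q n p.2 (W p.1)) = tile Q n p.2 (frontier (W p.1)) := by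
    intro p
    obtain ⟨h, hh⟩ := tile_homeo hQ n p.2
    rw [hh, hh, h.image_frontier]
  have htc : ∀ p : Fin N × E, IsCompact (tile Q n p.2 (W p.1)) := fun p =>
    (hW p.1).image ((Q ^ n : E →L[ℝ] E).continuous.add continuous_const)
  have hsub : frontier (W i0) ⊆ ⋃ p ∈ P.erase q, tile Q n p.2 (frontier (W p.1)) := by
    intro z hz
    have hz' := hz
    rw [hcov] at hz'
    have := finset_frontier P _ hz'
    simp only [mem_iUnion, hfr] at this ⊢
    obtain ⟨p, hp, hzp⟩ := this
    refine ⟨p, Finset.mem_erase.2 ⟨?_, hp⟩, hzp⟩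
    rintro rfl
    rw [← hfr] at hzp
    exact hz.2 (hqint ((htc p).isClosed.frontier_subset hzp))
  have h1 : μ (frontier (W i0)) ≤ r * ∑ p ∈ P.erase q, c ^ n * μ (W p.1) := by
    refine (measure_mono hsub).trans ((measure_biUnion_finset_le _ _).trans ?_)
    rw [Finset.mul_sum]
    refine Finset.sum_le_sum fun p _ => ?_
    rw [volume_tile, ← hc, mul_left_comm]
    gcongr
    exact hrb p.1
  have h2 : μ (W i0) = ∑ p ∈ P, c ^ n * μ (W p.1) := by
    conv_lhs => rw [hcov]
    rw [measure_biUnion_finset₀]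
    · simp only [volume_tile, ← hc]
    · intro p hp p' hp' hpp
      exact disj μ hQ.1 hIFS hdisj n i0 p p' (by simpa [hP] using hp) (by simpa [hP] using hp') hpp
    · exact fun p _ => (htc p).isClosed.measurableSet.nullMeasurableSet
  rw [← Finset.add_sum_erase _ _ hq] at h2
  have h3 : r * ∑ p ∈ P.erase q, c ^ n * μ (W p.1) + r * (c ^ n * μ (W q.1)) ≤
      r * ∑ p ∈ P.erase q, c ^ n * μ (W p.1) + 0 := by
    rw [← mul_add, add_comm (∑ p ∈ P.erase q, _), ← h2, ← hr0eq, add_zero]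
    exact h1
  have hfin : r * ∑ p ∈ P.erase q, c ^ n * μ (W p.1) ≠ ⊤ := by
    refine ne_top_of_le_ne_top hft ?_
    rw [hr0eq, h2]
    gcongr
    exact le_add_self
  have h4 := (ENNReal.add_le_add_iff_left hfin).1 h3
  exact mul_ne_zero hr0 (mul_ne_zero (hc0 n) (hvol q.1).ne') (le_antisymm h4 zero_le)

end general
end WindowIFS

/-- if the unique solution of the window IFS has windows of positive
measure and is row-wise measure-disjoint, then each window `W_i` is a perfect set,
is topologically regular (`W_i = closure (interior W_i)`), and has a boundary of
Lebesgue measure zero. -/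
theorem stmt2
    {N m : ℕ} (hN : 1 ≤ N) (hm : 1 ≤ m)
    (T : Fin N → Fin N → Finset (EuclideanSpace ℝ (Fin m)))
    (M : Matrix (Fin N) (Fin N) ℝ)
    (hM : ∀ i j, M i j = (T i j).card)
    (hprim : ∃ k : ℕ, ∀ i j, 0 < (M ^ k) i j)
    (lam : ℝ) (hlam : 1 < lam)
    (Q : EuclideanSpace ℝ (Fin m) →L[ℝ] EuclideanSpace ℝ (Fin m))
    (hQbij : Function.Bijective Q)
    (hQcontr : ‖Q‖ < 1)
    (hQdet : |Q.det| = 1 / lam)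
    (W : Fin N → Set (EuclideanSpace ℝ (Fin m)))
    (hWne : ∀ i, (W i).Nonempty) (hWcp : ∀ i, IsCompact (W i))
    (hIFS : ∀ i, W i = ⋃ j, ⋃ t ∈ T i j, (fun x => Q x + t) '' W j)
    (hvol : ∀ i, 0 < volume (W i))
    (hdisj : ∀ i j j' : Fin N, ∀ t ∈ T i j, ∀ t' ∈ T i j', (j, t) ≠ (j', t') →
      volume (((fun x => Q x + t) '' W j) ∩ ((fun x => Q x + t') '' W j')) = 0) :
    ∀ i, Perfect (W i) ∧ W i = closure (interior (W i)) ∧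
      volume (frontier (W i)) = 0 := by
  classical
  have hdet : Q.det ≠ 0 := by
    intro h
    rw [h, abs_zero] at hQdet
    have : 0 < 1 / lam := by positivity
    linarith
  obtain ⟨D, hD0, hD⟩ : ∃ D : ℝ, 0 ≤ D ∧ ∀ j, ∀ x ∈ W j, ‖x‖ ≤ D := by
    have hb : Bornology.IsBounded (⋃ j, W j) :=
      (isCompact_iUnion hWcp).isBounded
    obtain ⟨D, hD⟩ := hb.exists_norm_le
    exact ⟨max D 0, le_max_right _ _, fun j x hx =>
      (hD x (mem_iUnion.2 ⟨j, hx⟩)).trans (le_max_left _ _)⟩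
  have hsub : ∀ n i, ∀ p ∈ WindowIFS.addr T Q n i, WindowIFS.tile Q n p.2 (W p.1) ⊆ W i := by
    intro n i p hp
    conv_rhs => rw [WindowIFS.cover hIFS n i]
    exact subset_biUnion_of_mem
      (u := fun p : Fin N × EuclideanSpace ℝ (Fin m) => WindowIFS.tile Q n p.2 (W p.1)) hp
  have htile : ∀ n i, ∀ p ∈ WindowIFS.addr T Q n i, (interior (W p.1)).Nonempty →
      (WindowIFS.tile Q n p.2 (W p.1) ∩ interior (W i)).Nonempty := by
    intro n i p hp hne
    obtain ⟨h, hh⟩ := WindowIFS.tile_homeo hQbij n p.2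
    have h1 : (interior (WindowIFS.tile Q n p.2 (W p.1))).Nonempty := by
      rw [hh, ← h.image_interior]
      exact hne.image _
    obtain ⟨z, hz⟩ := h1
    exact ⟨z, interior_subset hz, interior_mono (hsub n i p hp) hz⟩
  have hintW : ∀ i, (interior (W i)).Nonempty := by
    intro i
    obtain ⟨j, hj⟩ := WindowIFS.exists_interior volume hQbij hQcontr hdet hWcp hvol hIFS hdisj
      hD0 hD i
    obtain ⟨k, hk⟩ := hprim
    obtain ⟨s, hs⟩ := WindowIFS.prim (Q := Q) hM k i j (hk i j).ne'
    exact (htile k i (j, s) hs hj).mono inter_subset_right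
  intro i
  have hreg : W i = closure (interior (W i)) := by
    refine subset_antisymm ?_ (closure_minimal interior_subset (hWcp i).isClosed)
    intro x hx
    rw [Metric.mem_closure_iff]
    intro δ hδ
    obtain ⟨n, hn⟩ : ∃ n : ℕ, ‖Q‖ ^ n * (2 * D) < δ := by
      have := (tendsto_pow_atTop_nhds_zero_of_lt_one (norm_nonneg Q) hQcontr).mul_const (2 * D)
      rw [zero_mul] at this
      exact (this.eventually (gt_mem_nhds hδ)).exists
    rw [WindowIFS.cover hIFS n i] at hx
    simp only [mem_iUnion] at hx
    obtain ⟨p, hp, hxp⟩ := hx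
    obtain ⟨z, hz1, hz2⟩ := htile n i p hp (hintW p.1)
    exact ⟨z, hz2, (WindowIFS.tile_small hD n p.2 p.1 hxp hz1).trans_lt hn⟩
  refine ⟨?_, hreg, WindowIFS.frontier_null volume hQbij hQcontr hdet hWcp hvol hIFS hdisj hD
    hintW i⟩
  have : Nonempty (Fin m) := ⟨⟨0, hm⟩⟩
  have hp : Preperfect (interior (W i)) := by
    have := (PerfectSpace.univ_perfect (EuclideanSpace ℝ (Fin m))).acc.open_inter
      (isOpen_interior (s := W i))
    rwa [inter_univ] at this
  rw [hreg]
  exact hp.perfect_closure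
end

section
/- Fix α > 0 and let M_α be the set of N-tuples (ν_1,…,ν_N) of finite positive Borel measures on ℝ^m with total masses ‖ν_i‖ = α·v_i. Define Φ on N-tuples of finite positive measures by Φ(ν)_i = λ^{−1} Σ_{j=1}^{N} Σ_{t∈T_{ij}} (x ↦ Q·x + t)_*(ν_j). Then Φ maps M_α into M_α, and M_α contains precisely one fixed point of Φ, namely the tuple given by ν_i = (α·v_i / vol(W_i)) · (Lebesgue measure restricted to W_i) for 1 ≤ i ≤ N. -/
open MeasureTheory Filter Matrix Topology Set

lemma aux_cont {m : ℕ} (ν : Measure (EuclideanSpace ℝ (Fin m))) [IsFiniteMeasure ν] :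
    Continuous (charFun ν) := by
  have : charFun ν = fun t => ∫ x, Complex.exp ((inner ℝ x t : ℝ) * Complex.I) ∂ν := by
    ext t; exact charFun_apply t
  rw [this]
  refine continuous_of_dominated (bound := fun _ => 1) ?_ ?_ ?_ ?_
  · intro t
    exact Continuous.aestronglyMeasurable (by fun_prop)
  · intro t
    exact ae_of_all _ fun x => by rw [Complex.norm_exp_ofReal_mul_I]
  · exact integrable_const _
  · exact ae_of_all _ fun x => by fun_prop

lemma aux_map {m : ℕ} (Q : EuclideanSpace ℝ (Fin m) →L[ℝ] EuclideanSpace ℝ (Fin m))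
    (t : EuclideanSpace ℝ (Fin m)) (ν : Measure (EuclideanSpace ℝ (Fin m)))
    (ξ : EuclideanSpace ℝ (Fin m)) :
    charFun (Measure.map (fun x => Q x + t) ν) ξ =
      Complex.exp ((inner ℝ t ξ : ℝ) * Complex.I) * charFun ν (Q.adjoint ξ) := by
  rw [charFun_apply, integral_map (by fun_prop)
    (Continuous.aestronglyMeasurable (by fun_prop)), charFun_apply, ← integral_const_mul]
  congr 1
  ext x
  rw [← Complex.exp_add, ContinuousLinearMap.adjoint_inner_right, inner_add_left]
  congr 1
  push_cast
  ring

lemma aux_phi {N m : ℕ}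
    (T : Fin N → Fin N → Finset (EuclideanSpace ℝ (Fin m)))
    (lam : ℝ) (hlam : 1 < lam)
    (Q : EuclideanSpace ℝ (Fin m) →L[ℝ] EuclideanSpace ℝ (Fin m))
    (ν : Fin N → Measure (EuclideanSpace ℝ (Fin m))) [∀ i, IsFiniteMeasure (ν i)]
    (h : ∀ i, (ENNReal.ofReal lam)⁻¹ •
      ∑ j, ∑ t ∈ T i j, Measure.map (fun x => Q x + t) (ν j) = ν i)
    (i : Fin N) (ξ : EuclideanSpace ℝ (Fin m)) :
    charFun (ν i) ξ = (lam⁻¹ : ℝ) • ∑ j, ∑ t ∈ T i j,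
      Complex.exp ((inner ℝ t ξ : ℝ) * Complex.I) * charFun (ν j) (Q.adjoint ξ) := by
  have hI : ∀ (ρ : Measure (EuclideanSpace ℝ (Fin m))) [IsFiniteMeasure ρ],
      Integrable (fun x => Complex.exp ((inner ℝ x ξ : ℝ) * Complex.I)) ρ := by
    intro ρ _
    refine Integrable.of_bound (C := 1) (Continuous.aestronglyMeasurable (by fun_prop)) ?_
    exact ae_of_all _ fun x => by rw [Complex.norm_exp_ofReal_mul_I]
  conv_lhs => rw [← h i]
  rw [charFun_apply, integral_smul_measure, integral_finsetSum_measure]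
  · congr 1
    · rw [ENNReal.toReal_inv, ENNReal.toReal_ofReal (by linarith)]
    · refine Finset.sum_congr rfl fun j _ => ?_
      rw [integral_finsetSum_measure]
      · refine Finset.sum_congr rfl fun t _ => ?_
        rw [← aux_map, charFun_apply]
      · intro t _
        exact hI _
  · intro j _
    rw [integrable_finsetSum_measure]
    intro t _
    exact hI _

lemma aux_unique {N m : ℕ}
    (T : Fin N → Fin N → Finset (EuclideanSpace ℝ (Fin m)))
    (lam : ℝ) (hlam : 1 < lam)
    (v : Fin N → ℝ)
    (hv : ∀ i, ∑ j, ((T i j).card : ℝ) * v j = lam * v i) (hvpos : ∀ i, 0 < v i)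
    (Q : EuclideanSpace ℝ (Fin m) →L[ℝ] EuclideanSpace ℝ (Fin m))
    (hQcontr : ‖Q‖ < 1)
    (ν ν' : Fin N → Measure (EuclideanSpace ℝ (Fin m)))
    [∀ i, IsFiniteMeasure (ν i)] [∀ i, IsFiniteMeasure (ν' i)]
    (hm : ∀ i, ν i univ = ν' i univ)
    (h : ∀ i, (ENNReal.ofReal lam)⁻¹ •
      ∑ j, ∑ t ∈ T i j, Measure.map (fun x => Q x + t) (ν j) = ν i)
    (h' : ∀ i, (ENNReal.ofReal lam)⁻¹ •
      ∑ j, ∑ t ∈ T i j, Measure.map (fun x => Q x + t) (ν' j) = ν' i) : ν = ν' := by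
  set D : Fin N → EuclideanSpace ℝ (Fin m) → ℂ :=
    fun i ξ => charFun (ν i) ξ - charFun (ν' i) ξ with hD
  have hDc : ∀ i, Continuous (D i) := fun i => (aux_cont _).sub (aux_cont _)
  have hD0 : ∀ i, D i 0 = 0 := by
    intro i
    simp [hD, charFun_zero, Measure.real, hm i]
  set A := Q.adjoint with hA
  have hAn : ‖A‖ < 1 := by
    rw [hA, LinearIsometryEquiv.norm_map]; exact hQcontr
  have hstep : ∀ i ξ, D i ξ = (lam⁻¹ : ℝ) • ∑ j, ∑ t ∈ T i j,
      Complex.exp ((inner ℝ t ξ : ℝ) * Complex.I) * D j (A ξ) := by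
    intro i ξ
    simp only [hD]
    rw [aux_phi T lam hlam Q ν h i ξ, aux_phi T lam hlam Q ν' h' i ξ, ← smul_sub]
    simp only [mul_sub, Finset.sum_sub_distrib, hA]
  have hb : ∀ (K : ℝ) ξ, (∀ j, ‖D j (A ξ)‖ ≤ K * v j) → ∀ i, ‖D i ξ‖ ≤ K * v i := by
    intro K ξ hK i
    rw [hstep, norm_smul, Real.norm_of_nonneg (by positivity), inv_mul_le_iff₀ (by linarith)]
    calc _ ≤ ∑ j, ∑ t ∈ T i j, K * v j := by
          refine (norm_sum_le _ _).trans (Finset.sum_le_sum fun j _ => ?_)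
          refine (norm_sum_le _ _).trans (Finset.sum_le_sum fun t _ => ?_)
          rw [norm_mul, Complex.norm_exp_ofReal_mul_I, one_mul]
          exact hK j
      _ = K * ∑ j, ((T i j).card : ℝ) * v j := by
          simp only [Finset.sum_const, nsmul_eq_mul, Finset.mul_sum]
          exact Finset.sum_congr rfl fun j _ => by ring
      _ = _ := by rw [hv]; ring
  have hbn : ∀ (n : ℕ) (K : ℝ) ξ, (∀ j, ‖D j (A^[n] ξ)‖ ≤ K * v j) →
      ∀ i, ‖D i ξ‖ ≤ K * v i := by
    intro n
    induction n with
    | zero => intro K ξ hK; exact hK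
    | succ n ih =>
      intro K ξ hK
      exact hb K ξ (ih K (A ξ) hK)
  have hlim : ∀ ξ, Tendsto (fun n : ℕ => A^[n] ξ) atTop (𝓝 0) := by
    intro ξ
    have hle : ∀ n : ℕ, ‖A^[n] ξ‖ ≤ ‖A‖ ^ n * ‖ξ‖ := by
      intro n
      induction n with
      | zero => simp
      | succ n ih =>
        rw [Function.iterate_succ_apply']
        refine (A.le_opNorm _).trans ?_
        rw [pow_succ', mul_assoc]
        gcongr
    refine squeeze_zero_norm hle ?_
    simpa using (tendsto_pow_atTop_nhds_zero_of_lt_one (norm_nonneg A) hAn).mul_const ‖ξ‖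
  have hzero : ∀ i ξ, D i ξ = 0 := by
    intro i ξ
    have key : ∀ ε : ℝ, 0 < ε → ‖D i ξ‖ ≤ ε * v i := by
      intro ε hε
      have : ∀ᶠ n : ℕ in atTop, ∀ j, ‖D j (A^[n] ξ)‖ ≤ ε * v j := by
        rw [eventually_all]
        intro j
        have h1 : Tendsto (fun n : ℕ => ‖D j (A^[n] ξ)‖) atTop (𝓝 0) := by
          have := (((hDc j).norm.tendsto 0).comp (hlim ξ))
          simpa [hD0, Function.comp_def] using this
        exact (h1.eventually_lt_const (mul_pos hε (hvpos j))).mono fun n hn => hn.le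
      obtain ⟨n, hn⟩ := this.exists
      exact hbn n ε ξ hn i
    rw [← norm_le_zero_iff]
    refine le_of_forall_pos_le_add fun ε hε => ?_
    have := key (ε / v i) (div_pos hε (hvpos i))
    rwa [div_mul_cancel₀ _ (hvpos i).ne', ← zero_add ε] at this
  funext i
  refine Measure.ext_of_charFun ?_
  ext ξ
  exact sub_eq_zero.mp (hzero i ξ)

lemma aux_fix {N m : ℕ}
    (T : Fin N → Fin N → Finset (EuclideanSpace ℝ (Fin m)))
    (lam : ℝ) (hlam : 1 < lam)
    (Q : EuclideanSpace ℝ (Fin m) →L[ℝ] EuclideanSpace ℝ (Fin m))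
    (hQbij : Function.Bijective Q)
    (hQdet : |Q.det| = 1 / lam)
    (W : Fin N → Set (EuclideanSpace ℝ (Fin m)))
    (hWcp : ∀ i, IsCompact (W i))
    (hIFS : ∀ i, W i = ⋃ j, ⋃ t ∈ T i j, (fun x => Q x + t) '' W j)
    (hdisj : ∀ i j j' : Fin N, ∀ t ∈ T i j, ∀ t' ∈ T i j', (j, t) ≠ (j', t') →
      volume (((fun x => Q x + t) '' W j) ∩ ((fun x => Q x + t') '' W j')) = 0)
    (i : Fin N) :
    ∑ j, ∑ t ∈ T i j, Measure.map (fun x => Q x + t) (volume.restrict (W j)) =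
      ENNReal.ofReal lam • volume.restrict (W i) := by
  have hdet0 : LinearMap.det (Q : EuclideanSpace ℝ (Fin m) →ₗ[ℝ] EuclideanSpace ℝ (Fin m)) ≠ 0 := by
    intro h0
    have : |Q.det| = 0 := by rw [ContinuousLinearMap.det, h0, abs_zero]
    rw [this] at hQdet
    have : 0 < 1 / lam := by positivity
    linarith
  have hcpt : ∀ j t, IsCompact ((fun x => Q x + t) '' W j) := fun j t =>
    (hWcp j).image (by fun_prop)
  have hvolmap : ∀ t, Measure.map (fun x => Q x + t) volume =
      ENNReal.ofReal lam • (volume : Measure (EuclideanSpace ℝ (Fin m))) := by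
    intro t
    have e : (fun x => Q x + t) = (fun x => x + t) ∘ Q := rfl
    rw [e, ← Measure.map_map (by fun_prop) (by fun_prop)]
    have := Measure.map_linearMap_addHaar_eq_smul_addHaar
      (volume : Measure (EuclideanSpace ℝ (Fin m))) hdet0
    rw [ContinuousLinearMap.coe_coe] at this
    rw [this, Measure.map_smul, map_add_right_eq_self]
    congr 2
    rw [abs_inv]
    change |Q.det|⁻¹ = lam
    rw [hQdet]; simp
  have hinj : ∀ t, Function.Injective (fun x => Q x + t) := fun t x y hxy =>
    hQbij.1 (add_right_cancel hxy)
  have hmap : ∀ j t, Measure.map (fun x => Q x + t) (volume.restrict (W j)) =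
      ENNReal.ofReal lam • volume.restrict ((fun x => Q x + t) '' W j) := by
    intro j t
    rw [← Measure.restrict_smul, ← hvolmap t,
      Measure.restrict_map (by fun_prop) (hcpt j t).measurableSet, preimage_image_eq _ (hinj t)]
  simp only [hmap, ← Finset.smul_sum]
  congr 1
  have hU : W i = ⋃ p : (Σ j, T i j), (fun x => Q x + p.2.1) '' W p.1 := by
    conv_lhs => rw [hIFS i]
    ext x
    simp only [mem_iUnion, Sigma.exists, Subtype.exists]
  rw [hU, Measure.restrict_iUnion_ae, Measure.sum_fintype, Fintype.sum_sigma]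
  · refine Finset.sum_congr rfl fun j _ => ?_
    exact (Finset.sum_coe_sort (T i j)
      (fun t => volume.restrict ((fun x => Q x + t) '' W j))).symm
  · rintro ⟨j, t, ht⟩ ⟨j', t', ht'⟩ hne
    refine hdisj i j j' t ht t' ht' ?_
    intro heq
    apply hne
    obtain ⟨rfl, rfl⟩ := Prod.mk.inj heq
    rfl
  · intro p
    exact (hcpt _ _).measurableSet.nullMeasurableSet



/-- the map `Φ(ν)_i = λ⁻¹ Σ_j Σ_{t∈T_{ij}} (x↦Qx+t)_*(ν_j)` maps the
space `M_α` of `N`-tuples of finite positive measures with masses `α v_i` into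
itself, and `M_α` contains precisely one fixed point of `Φ`, namely
`ν_i = (α v_i / vol W_i) · Leb|_{W_i}`. -/
theorem stmt13
    {N m : ℕ} (hN : 1 ≤ N) (hm : 1 ≤ m)
    (T : Fin N → Fin N → Finset (EuclideanSpace ℝ (Fin m)))
    (M : Matrix (Fin N) (Fin N) ℝ)
    (hM : ∀ i j, M i j = (T i j).card)
    (hprim : ∃ k : ℕ, ∀ i j, 0 < (M ^ k) i j)
    (lam : ℝ) (hlam : 1 < lam)
    (v : Fin N → ℝ)
    (hv : M.mulVec v = lam • v) (hvpos : ∀ i, 0 < v i) (hvsum : ∑ i, v i = 1)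
    (Q : EuclideanSpace ℝ (Fin m) →L[ℝ] EuclideanSpace ℝ (Fin m))
    (hQbij : Function.Bijective Q)
    (hQcontr : ‖Q‖ < 1)
    (hQdet : |Q.det| = 1 / lam)
    (W : Fin N → Set (EuclideanSpace ℝ (Fin m)))
    (hWne : ∀ i, (W i).Nonempty) (hWcp : ∀ i, IsCompact (W i))
    (hIFS : ∀ i, W i = ⋃ j, ⋃ t ∈ T i j, (fun x => Q x + t) '' W j)
    (hdisj : ∀ i j j' : Fin N, ∀ t ∈ T i j, ∀ t' ∈ T i j', (j, t) ≠ (j', t') →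
      volume (((fun x => Q x + t) '' W j) ∩ ((fun x => Q x + t') '' W j')) = 0)
    (η : ℝ) (hη : 0 < η)
    (hvol : ∀ i, volume (W i) = ENNReal.ofReal (η * v i))
    (α : ℝ) (hα : 0 < α)
    (Φ : (Fin N → Measure (EuclideanSpace ℝ (Fin m))) →
      (Fin N → Measure (EuclideanSpace ℝ (Fin m))))
    (hΦ : ∀ ν i, Φ ν i = (ENNReal.ofReal lam)⁻¹ •
      ∑ j, ∑ t ∈ T i j, Measure.map (fun x => Q x + t) (ν j))
    (μ : Fin N → Measure (EuclideanSpace ℝ (Fin m)))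
    (hμ : ∀ i, μ i =
      (ENNReal.ofReal (α * v i) / volume (W i)) • volume.restrict (W i)) :
    (∀ ν : Fin N → Measure (EuclideanSpace ℝ (Fin m)),
      (∀ i, ν i Set.univ = ENNReal.ofReal (α * v i)) →
      ∀ i, Φ ν i Set.univ = ENNReal.ofReal (α * v i)) ∧
    (∀ i, μ i Set.univ = ENNReal.ofReal (α * v i)) ∧
    Φ μ = μ ∧
    (∀ ν : Fin N → Measure (EuclideanSpace ℝ (Fin m)),
      (∀ i, ν i Set.univ = ENNReal.ofReal (α * v i)) → Φ ν = ν → ν = μ) := by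
  have hv' : ∀ i, ∑ j, ((T i j).card : ℝ) * v j = lam * v i := by
    intro i
    have := congrFun hv i
    simpa [Matrix.mulVec, dotProduct, hM] using this
  have hlam0 : 0 < lam := by linarith
  have hμ1 : ∀ i, μ i = ENNReal.ofReal (α / η) • volume.restrict (W i) := by
    intro i
    rw [hμ i, hvol i, ← ENNReal.ofReal_div_of_pos (mul_pos hη (hvpos i)),
      mul_div_mul_right _ _ (hvpos i).ne']
  have hμmass : ∀ i, μ i Set.univ = ENNReal.ofReal (α * v i) := by
    intro i
    rw [hμ1, Measure.smul_apply, Measure.restrict_apply_univ, hvol i, smul_eq_mul,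
      ← ENNReal.ofReal_mul (by positivity)]
    congr 1
    field_simp
  have hΦμ : Φ μ = μ := by
    funext i
    have hmeas : ∀ t, AEMeasurable (fun x => Q x + t)
      (volume : Measure (EuclideanSpace ℝ (Fin m))) := fun t => by fun_prop
    rw [hΦ]
    simp only [hμ1, Measure.map_smul, ← Finset.smul_sum]
    rw [aux_fix T lam hlam Q hQbij hQdet W hWcp hIFS hdisj i, smul_smul, smul_smul]
    congr 1
    rw [mul_right_comm, ENNReal.inv_mul_cancel, one_mul]
    · simpa using hlam0
    · exact ENNReal.ofReal_ne_top
  refine ⟨?_, hμmass, hΦμ, ?_⟩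
  · intro ν hν i
    rw [hΦ, Measure.smul_apply]
    simp only [Measure.finsetSum_apply]
    have : ∀ j t, Measure.map (fun x => Q x + t) (ν j) univ = ENNReal.ofReal (α * v j) := by
      intro j t
      rw [Measure.map_apply (by fun_prop) MeasurableSet.univ, preimage_univ, hν]
    simp only [this, Finset.sum_const, nsmul_eq_mul]
    have h2 : ∑ j, ((T i j).card : ENNReal) * ENNReal.ofReal (α * v j) =
        ENNReal.ofReal (lam * (α * v i)) := by
      have : lam * (α * v i) = ∑ j, ((T i j).card : ℝ) * (α * v j) := by
        rw [mul_left_comm, ← hv', Finset.mul_sum]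
        exact Finset.sum_congr rfl fun j _ => by ring
      rw [this, ENNReal.ofReal_sum_of_nonneg]
      · refine Finset.sum_congr rfl fun j _ => ?_
        rw [ENNReal.ofReal_mul (p := ((T i j).card : ℝ)) (Nat.cast_nonneg _), ENNReal.ofReal_natCast]
      · intro j _
        exact mul_nonneg (Nat.cast_nonneg _) (mul_nonneg hα.le (hvpos j).le)
    rw [h2, ENNReal.ofReal_mul hlam0.le, smul_eq_mul, ← mul_assoc, ENNReal.inv_mul_cancel, one_mul]
    · simpa using hlam0
    · exact ENNReal.ofReal_ne_top
  · intro ν hν hfix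
    have i1 : ∀ i, IsFiniteMeasure (ν i) := fun i => ⟨by rw [hν]; exact ENNReal.ofReal_lt_top⟩
    have i2 : ∀ i, IsFiniteMeasure (μ i) := fun i => ⟨by rw [hμmass]; exact ENNReal.ofReal_lt_top⟩
    refine aux_unique T lam hlam v hv' hvpos Q hQcontr ν μ (fun i => by rw [hν, hμmass]) ?_ ?_
    · intro i; rw [← hΦ, hfix]
    · intro i; rw [← hΦ, hΦμ]
end
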